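/- Let V be an n-graded vector space over a field 𝕂 of characteristic 0 and let α : M(V) → M(V) be the multigraded alternator. Then for all homogeneous K₁ ∈ M^{(k₁,κ₁)}(V) and K₂ ∈ M^{(k₂,κ₂)}(V) one has α(j(αK₁)(αK₂)) = α(j(K₁)K₂). -/

import Mathlib

namespace NR

open Finset

/-- The sign `(-1)^z` for an integer `z`. -/
def sgn (z : ℤ) : ℤ := (-1) ^ z.natAbs

/-- The inner product `⟨x,y⟩ = ∑ i, xⁱ yⁱ` of multidegrees `x, y ∈ ℤⁿ`. -/
def pairZ (n : ℕ) (x y : Fin n → ℤ) : ℤ := ∑ i, x i * y i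

/-- The inner product of `(n+1)`-degrees in `ℤ × ℤⁿ`. -/
def prE (n : ℕ) (g h : ℤ × (Fin n → ℤ)) : ℤ := g.1 * h.1 + pairZ n g.2 h.2

/-- Shift a sequence: `shiftSeq f i = (f i, f (i+1), …)`. -/
def shiftSeq {β : Type*} (f : ℕ → β) (i : ℕ) : ℕ → β := fun m => f (m + i)

/-- Insert the value `c` at slot `i` of the sequence `f`, where `c` replaces
`a` consecutive entries of `f` (the entries `f i, …, f (i+a-1)`). -/
def insSeq {β : Type*} (a i : ℕ) (c : β) (f : ℕ → β) : ℕ → β :=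
  fun l => if l < i then f l else if l = i then c else f (l + a - 1)

/-- Permute the first `a` entries of a sequence by `σ`. -/
def permSeq {β : Type*} (a : ℕ) (σ : Equiv.Perm (Fin a)) (f : ℕ → β) : ℕ → β :=
  fun l => if h : l < a then f ((σ ⟨l, h⟩ : Fin a) : ℕ) else f l

/-- The multigraded sign `sign(σ, x)` of a permutation `σ` of `a` symbols with respect to
the multidegrees `x 0, …, x (a-1)`; it is the ordinary sign times the Koszul sign
collected over the inversions of `σ`. -/
def gsign {G : Type*} (pr : G → G → ℤ) (a : ℕ) (σ : Equiv.Perm (Fin a)) (x : ℕ → G) : ℤ :=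
  ((Equiv.Perm.sign σ : ℤˣ) : ℤ) *
    (-1) ^ (∑ p ∈ Finset.univ.filter
        (fun p : Fin a × Fin a => p.1 < p.2 ∧ σ p.2 < σ p.1),
        pr (x ((σ p.1 : Fin a) : ℕ)) (x ((σ p.2 : Fin a) : ℕ))).natAbs

section Ops

variable {G U : Type*} [AddCommGroup G] [AddCommGroup U]

/-- The operation `j(K₁)K₂` of the multigraded Nijenhuis–Richardson calculus.
`K₁` represents an element of `M^{(k₁,κ₁)}(U)` of arity `a₁ = k₁+1` and `K₂` one of
`M^{(k₂,κ₂)}(U)` of arity `a₂ = k₂+1`; an element of arity `a` is coded as a function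
taking the sequence of multidegrees of the (homogeneous) arguments and the sequence of
arguments, and depending only on the first `a` of them. -/
def jop (pr : G → G → ℤ) (a₁ : ℕ) (κ₁ : G) (a₂ : ℕ) (κ₂ : G)
    (K₁ K₂ : (ℕ → G) → (ℕ → U) → U) : (ℕ → G) → (ℕ → U) → U :=
  fun x X => ∑ i ∈ Finset.range a₂,
    sgn (((a₁ : ℤ) - 1) * (i : ℤ) + pr κ₁ (κ₂ + ∑ l ∈ Finset.range i, x l)) •
      K₂ (insSeq a₁ i ((∑ m ∈ Finset.range a₁, x (m + i)) + κ₁) x)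
         (insSeq a₁ i (K₁ (shiftSeq x i) (shiftSeq X i)) X)

/-- The multigraded bracket `[K₁,K₂]^Δ = j(K₁)K₂ - (-1)^{k₁k₂+⟨κ₁,κ₂⟩} j(K₂)K₁`. -/
def brD (pr : G → G → ℤ) (a₁ : ℕ) (κ₁ : G) (a₂ : ℕ) (κ₂ : G)
    (K₁ K₂ : (ℕ → G) → (ℕ → U) → U) : (ℕ → G) → (ℕ → U) → U :=
  fun x X => jop pr a₁ κ₁ a₂ κ₂ K₁ K₂ x X
    - sgn (((a₁ : ℤ) - 1) * ((a₂ : ℤ) - 1) + pr κ₁ κ₂) • jop pr a₂ κ₂ a₁ κ₁ K₂ K₁ x X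

end Ops

/-- `K` represents a (`a`-linear) element of `M(U)`: it does not depend on the degree
sequence, depends only on the first `a` arguments, and is `𝕂`-multilinear in them. -/
def IsML (𝕂 : Type*) [Field 𝕂] {G U U' : Type*} [AddCommGroup U] [Module 𝕂 U]
    [AddCommGroup U'] [Module 𝕂 U'] (a : ℕ) (K : (ℕ → G) → (ℕ → U) → U') : Prop :=
  (∀ x x' X, K x X = K x' X) ∧
  (∀ x X X', (∀ i, i < a → X i = X' i) → K x X = K x X') ∧
  (∀ x X i, i < a →
    (∀ u v : U, K x (Function.update X i (u + v))
        = K x (Function.update X i u) + K x (Function.update X i v)) ∧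
    (∀ (r : 𝕂) (u : U), K x (Function.update X i (r • u)) = r • K x (Function.update X i u)))

/-- `K ∈ M^{(a-1,κ)}(U)`: an `a`-linear map mapping `U^{x₀} × ⋯ × U^{x_{a-1}}` into
`U^{x₀+⋯+x_{a-1}+κ}`. -/
def MDeg (𝕂 : Type*) [Field 𝕂] {G U : Type*} [AddCommGroup G] [AddCommGroup U] [Module 𝕂 U]
    (gr : G → Submodule 𝕂 U) (a : ℕ) (κ : G) (K : (ℕ → G) → (ℕ → U) → U) : Prop :=
  IsML 𝕂 a K ∧
  ∀ x X, (∀ i, X i ∈ gr (x i)) → K x X ∈ gr ((∑ i ∈ Finset.range a, x i) + κ)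

/-- The multigraded alternator `α` on elements of arity `a`. -/
def alt (𝕂 : Type*) [Field 𝕂] {G U U' : Type*} [AddCommGroup U'] [Module 𝕂 U']
    (pr : G → G → ℤ) (a : ℕ) (K : (ℕ → G) → (ℕ → U) → U') : (ℕ → G) → (ℕ → U) → U' :=
  fun x X => (a.factorial : 𝕂)⁻¹ •
    ∑ σ : Equiv.Perm (Fin a),
      ((gsign pr a σ x : ℤ) : 𝕂) • K (permSeq a σ x) (permSeq a σ X)

/-- The operation `i(K₁)K₂ = ((k₁+k₂+1)!/((k₁+1)!(k₂+1)!)) α(j(K₁)K₂)`. -/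
def iop (𝕂 : Type*) [Field 𝕂] {G U : Type*} [AddCommGroup G] [AddCommGroup U] [Module 𝕂 U]
    (pr : G → G → ℤ) (a₁ : ℕ) (κ₁ : G) (a₂ : ℕ) (κ₂ : G)
    (K₁ K₂ : (ℕ → G) → (ℕ → U) → U) : (ℕ → G) → (ℕ → U) → U :=
  fun x X =>
    (((a₁ + a₂ - 1).factorial : 𝕂) / ((a₁.factorial : 𝕂) * (a₂.factorial : 𝕂))) •
      alt 𝕂 pr (a₁ + a₂ - 1) (jop pr a₁ κ₁ a₂ κ₂ K₁ K₂) x X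

/-- The multigraded Nijenhuis–Richardson bracket
`[K₁,K₂]^∧ = i(K₁)K₂ - (-1)^{k₁k₂+⟨κ₁,κ₂⟩} i(K₂)K₁`. -/
def brW (𝕂 : Type*) [Field 𝕂] {G U : Type*} [AddCommGroup G] [AddCommGroup U] [Module 𝕂 U]
    (pr : G → G → ℤ) (a₁ : ℕ) (κ₁ : G) (a₂ : ℕ) (κ₂ : G)
    (K₁ K₂ : (ℕ → G) → (ℕ → U) → U) : (ℕ → G) → (ℕ → U) → U :=
  fun x X => iop 𝕂 pr a₁ κ₁ a₂ κ₂ K₁ K₂ x X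
    - sgn (((a₁ : ℤ) - 1) * ((a₂ : ℤ) - 1) + pr κ₁ κ₂) • iop 𝕂 pr a₂ κ₂ a₁ κ₁ K₂ K₁ x X

/-- `K ∈ A^{(a-1,κ)}(U) = α(M^{(a-1,κ)}(U))`, i.e. `K ∈ M^{(a-1,κ)}(U)` and `K` is fixed by
the multigraded alternator (on homogeneous arguments). -/
def ADeg (𝕂 : Type*) [Field 𝕂] {G U : Type*} [AddCommGroup G] [AddCommGroup U] [Module 𝕂 U]
    (pr : G → G → ℤ) (gr : G → Submodule 𝕂 U) (a : ℕ) (κ : G)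
    (K : (ℕ → G) → (ℕ → U) → U) : Prop :=
  MDeg 𝕂 gr a κ K ∧
  ∀ x X, (∀ i, X i ∈ gr (x i)) → alt 𝕂 pr a K x X = K x X

/-- The bilinear map `P` coded as an element of arity `2`. -/
def KofBil {𝕂 : Type*} [Field 𝕂] {G U : Type*} [AddCommGroup U] [Module 𝕂 U]
    (P : U →ₗ[𝕂] U →ₗ[𝕂] U) : (ℕ → G) → (ℕ → U) → U :=
  fun _ X => P (X 0) (X 1)


/-! ### Signs -/

theorem sgn_eq (z : ℤ) : sgn z = ((Int.negOnePow z : ℤˣ) : ℤ) := by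
  unfold sgn
  rcases Int.even_or_odd z with h | h
  · rw [Int.negOnePow_even _ h, (Int.natAbs_even.2 h).neg_one_pow]; rfl
  · rw [Int.negOnePow_odd _ h, (Int.natAbs_odd.2 h).neg_one_pow]; rfl

theorem sgn_add (a b : ℤ) : sgn (a + b) = sgn a * sgn b := by
  simp [sgn_eq, Int.negOnePow_add]

theorem sgn_zero : sgn 0 = 1 := by simp [sgn]

theorem sgn_one : sgn 1 = -1 := by simp [sgn]

theorem sgn_mul_self (a : ℤ) : sgn a * sgn a = 1 := by
  rw [← sgn_add, sgn_eq, Int.negOnePow_even _ ⟨a, rfl⟩]; rfl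

theorem sgn_sum {ι : Type*} (s : Finset ι) (f : ι → ℤ) :
    sgn (∑ i ∈ s, f i) = ∏ i ∈ s, sgn (f i) := by
  classical
  induction s using Finset.induction_on with
  | empty => simp [sgn_zero]
  | insert a s ha ih => rw [Finset.sum_insert ha, Finset.prod_insert ha, sgn_add, ih]

theorem pairZ_comm (n : ℕ) (x y : Fin n → ℤ) : pairZ n x y = pairZ n y x := by
  simp [pairZ, mul_comm]

theorem pairZ_add_right (n : ℕ) (x y z : Fin n → ℤ) :
    pairZ n x (y + z) = pairZ n x y + pairZ n x z := by
  simp [pairZ, mul_add, Finset.sum_add_distrib]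

theorem pairZ_add_left (n : ℕ) (x y z : Fin n → ℤ) :
    pairZ n (x + y) z = pairZ n x z + pairZ n y z := by
  simp [pairZ, add_mul, Finset.sum_add_distrib]

theorem pairZ_zero_right (n : ℕ) (x : Fin n → ℤ) : pairZ n x 0 = 0 := by simp [pairZ]

/-! ### The multigraded sign is a cocycle -/

section Cocycle

variable {G : Type*} (pr : G → G → ℤ)

/-- contribution of a pair to the Koszul sign -/
def gpair {a : ℕ} (x : ℕ → G) (u v : Fin a) : ℤ :=
  if v < u then sgn (pr (x u) (x v)) else 1

theorem gsign_eq (a : ℕ) (σ : Equiv.Perm (Fin a)) (x : ℕ → G) :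
    gsign pr a σ x = ((Equiv.Perm.sign σ : ℤˣ) : ℤ) *
      ∏ p ∈ Finset.univ.filter (fun p : Fin a × Fin a => p.1 < p.2),
        gpair pr x (σ p.1) (σ p.2) := by
  unfold gsign
  congr 1
  change sgn _ = _
  rw [sgn_sum, ← Finset.filter_filter, Finset.prod_filter]
  rfl

theorem prod_reindex {a : ℕ} (τ : Equiv.Perm (Fin a)) (f : Fin a → Fin a → ℤ) :
    (∏ p ∈ Finset.univ.filter (fun p : Fin a × Fin a => p.1 < p.2),
      if τ p.1 < τ p.2 then f (τ p.1) (τ p.2) else f (τ p.2) (τ p.1))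
    = ∏ p ∈ Finset.univ.filter (fun p : Fin a × Fin a => p.1 < p.2), f p.1 p.2 := by
  refine Finset.prod_nbij'
    (fun p => if τ p.1 < τ p.2 then (τ p.1, τ p.2) else (τ p.2, τ p.1))
    (fun p => if τ.symm p.1 < τ.symm p.2 then (τ.symm p.1, τ.symm p.2)
      else (τ.symm p.2, τ.symm p.1)) ?_ ?_ ?_ ?_ ?_
  · rintro ⟨p, q⟩ h
    simp only [Finset.mem_filter, Finset.mem_univ, true_and] at h ⊢
    split_ifs with h1
    · exact h1
    · have : τ p ≠ τ q := fun e => h.ne (τ.injective e)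
      exact lt_of_le_of_ne (not_lt.1 h1) this.symm
  · rintro ⟨p, q⟩ h
    simp only [Finset.mem_filter, Finset.mem_univ, true_and] at h ⊢
    split_ifs with h1
    · exact h1
    · have : τ.symm p ≠ τ.symm q := fun e => h.ne (τ.symm.injective e)
      exact lt_of_le_of_ne (not_lt.1 h1) this.symm
  · rintro ⟨p, q⟩ h
    simp only [Finset.mem_filter, Finset.mem_univ, true_and] at h ⊢
    split_ifs with h1 h2 <;> simp_all [not_lt_of_gt]
  · rintro ⟨p, q⟩ h
    simp only [Finset.mem_filter, Finset.mem_univ, true_and] at h ⊢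
    split_ifs with h1 h2 <;> simp_all [not_lt_of_gt]
  · rintro ⟨p, q⟩ h
    simp only
    split_ifs <;> rfl

theorem permSeq_coe {β : Type*} (a : ℕ) (σ : Equiv.Perm (Fin a)) (f : ℕ → β) (u : Fin a) :
    permSeq a σ f u = f (σ u) := by
  simp [permSeq]

theorem gsign_mul (hpr : ∀ x y, pr x y = pr y x) (a : ℕ) (σ τ : Equiv.Perm (Fin a))
    (x : ℕ → G) :
    gsign pr a (σ * τ) x = gsign pr a σ x * gsign pr a τ (permSeq a σ x) := by
  rw [gsign_eq, gsign_eq, gsign_eq,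
    ← prod_reindex τ (fun u v => gpair pr x (σ u) (σ v)), mul_mul_mul_comm,
    ← Finset.prod_mul_distrib]
  congr 1
  · simp
  refine Finset.prod_congr rfl ?_
  rintro ⟨p, q⟩ h
  simp only [Finset.mem_filter, Finset.mem_univ, true_and] at h
  have hne : τ p ≠ τ q := fun e => h.ne (τ.injective e)
  have hne2 : σ (τ p) ≠ σ (τ q) := fun e => hne (σ.injective e)
  simp only [gpair, permSeq_coe, Equiv.Perm.mul_apply]
  rcases lt_or_gt_of_ne hne with h1 | h1
  · rcases lt_or_gt_of_ne hne2 with h2 | h2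
    · simp [h1, h2, not_lt_of_gt h1, not_lt_of_gt h2]
    · simp [h1, h2, not_lt_of_gt h1]
  · rcases lt_or_gt_of_ne hne2 with h2 | h2
    · simp [h1, h2, not_lt_of_gt h1, not_lt_of_gt h2, hpr (x (σ (τ q))), sgn_mul_self]
    · simp [h1, h2, not_lt_of_gt h1, not_lt_of_gt h2]

theorem gsign_one (a : ℕ) (x : ℕ → G) : gsign pr a 1 x = 1 := by
  rw [gsign_eq, Finset.prod_eq_one]
  · simp
  · rintro ⟨p, q⟩ h
    simp only [Finset.mem_filter, Finset.mem_univ, true_and] at h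
    simp [gpair, not_lt_of_gt h]

theorem gsign_congr (a : ℕ) (σ : Equiv.Perm (Fin a)) (x x' : ℕ → G)
    (h : ∀ i, i < a → x i = x' i) : gsign pr a σ x = gsign pr a σ x' := by
  unfold gsign
  congr 3
  refine Finset.sum_congr rfl fun p _ => ?_
  rw [h _ (σ p.1).2, h _ (σ p.2).2]

end Cocycle

/-- adjacent transposition of `j` and `j+1` -/
def sw (j l : ℕ) : ℕ := if l = j then j + 1 else if l = j + 1 then j else l

theorem sw_sw (j l : ℕ) : sw j (sw j l) = l := by
  unfold sw; split_ifs <;> omega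

/-- adjacent transposition in `Fin a` -/
def swp (a j : ℕ) (h : j + 1 < a) : Equiv.Perm (Fin a) :=
  Equiv.swap ⟨j, by omega⟩ ⟨j + 1, h⟩

theorem swp_val (a j : ℕ) (h : j + 1 < a) (u : Fin a) : ((swp a j h u : Fin a) : ℕ) = sw j u := by
  unfold swp sw
  rw [Equiv.swap_apply_def]
  simp only [Fin.ext_iff]
  split_ifs <;> simp

theorem permSeq_swp {β : Type*} (a j : ℕ) (h : j + 1 < a) (f : ℕ → β) :
    permSeq a (swp a j h) f = fun l => f (sw j l) := by
  funext l
  unfold permSeq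
  split_ifs with hl
  · rw [swp_val]
  · unfold sw; rw [if_neg (by omega), if_neg (by omega)]

theorem permSeq_mul {β : Type*} (a : ℕ) (σ τ : Equiv.Perm (Fin a)) (f : ℕ → β) :
    permSeq a (σ * τ) f = permSeq a τ (permSeq a σ f) := by
  funext l
  unfold permSeq
  by_cases hl : l < a
  · simp [hl]
  · simp [hl]

theorem permSeq_one {β : Type*} (a : ℕ) (f : ℕ → β) : permSeq a 1 f = f := by
  funext l; unfold permSeq; split_ifs <;> rfl

theorem gsign_swp {G : Type*} (pr : G → G → ℤ) (hpr : ∀ x y, pr x y = pr y x)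
    (a j : ℕ) (h : j + 1 < a) (x : ℕ → G) :
    gsign pr a (swp a j h) x = - sgn (pr (x j) (x (j + 1))) := by
  rw [gsign_eq, Finset.prod_eq_single (⟨j, by omega⟩, ⟨j + 1, h⟩)]
  · have : Equiv.Perm.sign (swp a j h) = -1 := Equiv.Perm.sign_swap (by simp [Fin.ext_iff])
    rw [this]
    simp [gpair, swp, hpr]
  · rintro ⟨p, q⟩ hpq hne
    simp only [Finset.mem_filter, Finset.mem_univ, true_and, Fin.lt_def] at hpq
    unfold gpair
    rw [if_neg]
    rw [Fin.lt_def, swp_val, swp_val]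
    simp only [ne_eq, Prod.mk.injEq, Fin.ext_iff] at hne
    dsimp only
    unfold sw
    split_ifs <;> omega
  · intro h; exact (h (Finset.mem_filter.2 ⟨Finset.mem_univ _, Fin.lt_def.2 (Nat.lt_succ_self j)⟩)).elim

theorem perm_ind (a : ℕ) (P : Equiv.Perm (Fin a) → Prop) (h1 : P 1)
    (hs : ∀ j (h : j + 1 < a) τ, P τ → P (swp a j h * τ)) (τ : Equiv.Perm (Fin a)) : P τ := by
  rcases a with _ | a
  · rwa [Subsingleton.elim τ 1]
  · have hτ : τ ∈ Submonoid.closure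
        (Set.range fun i : Fin a => Equiv.swap i.castSucc i.succ) := by
      rw [Equiv.Perm.mclosure_swap_castSucc_succ]; trivial
    induction hτ using Submonoid.closure_induction_left with
    | one => exact h1
    | mul_left s hmem y _ ih =>
      obtain ⟨i, rfl⟩ := hmem
      exact hs i (by omega) y ih

/-! ### The unnormalised alternator -/

section Alternator

variable {n : ℕ} {V : Type*} [AddCommGroup V]

/-- the unnormalised alternator -/
def SS (N : ℕ) (F : (ℕ → (Fin n → ℤ)) → (ℕ → V) → V) : (ℕ → (Fin n → ℤ)) → (ℕ → V) → V :=
  fun y Y => ∑ ρ : Equiv.Perm (Fin N),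
    gsign (pairZ n) N ρ y • F (permSeq N ρ y) (permSeq N ρ Y)

theorem SS_swap (N j : ℕ) (h : j + 1 < N) (F : (ℕ → (Fin n → ℤ)) → (ℕ → V) → V) :
    SS N (fun y Y => (- sgn (pairZ n (y j) (y (j + 1)))) •
      F (fun l => y (sw j l)) (fun l => Y (sw j l))) = SS N F := by
  funext y Y
  unfold SS
  refine Fintype.sum_equiv (Equiv.mulRight (swp N j h)) _ _ fun ρ => ?_
  simp only [Equiv.coe_mulRight]
  rw [gsign_mul _ (pairZ_comm n), gsign_swp _ (pairZ_comm n), permSeq_mul, permSeq_mul,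
    permSeq_swp, permSeq_swp, mul_smul]

/-- the cyclic move bringing entry `j+m` to position `j` -/
def cyc (j m l : ℕ) : ℕ :=
  if l < j then l else if l = j then j + m else if l ≤ j + m then l - 1 else l

theorem SS_cyc (N j m : ℕ) (h : j + m < N) (F : (ℕ → (Fin n → ℤ)) → (ℕ → V) → V) :
    SS N (fun y Y => (∏ t ∈ Finset.range m, - sgn (pairZ n (y (j + t)) (y (j + m)))) •
      F (fun l => y (cyc j m l)) (fun l => Y (cyc j m l))) = SS N F := by
  induction m with
  | zero =>
    have : ∀ l, cyc j 0 l = l := by intro l; unfold cyc; split_ifs <;> omega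
    simp [this]
  | succ m ih =>
    rw [← ih (by omega), ← SS_swap N (j + m) (by omega)
      (fun y Y => (∏ t ∈ Finset.range m, - sgn (pairZ n (y (j + t)) (y (j + m)))) •
      F (fun l => y (cyc j m l)) (fun l => Y (cyc j m l)))]
    congr 1
    funext y Y
    have e : ∀ l, cyc j (m + 1) l = sw (j + m) (cyc j m l) := by
      intro l; unfold cyc sw; split_ifs <;> omega
    have e1 : sw (j + m) (j + m) = j + (m + 1) := by unfold sw; simp; omega
    simp only [e, e1]
    rw [smul_smul, Finset.prod_range_succ, mul_comm]
    congr 2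
    refine Finset.prod_congr rfl fun t ht => ?_
    have : sw (j + m) (j + t) = j + t := by
      have := Finset.mem_range.1 ht
      unfold sw; split_ifs <;> omega
    rw [this]

/-- one summand of `jop` -/
def CC (a₁ : ℕ) (κ₁ κ₂ : Fin n → ℤ) (i : ℕ)
    (K₁ K₂ : (ℕ → (Fin n → ℤ)) → (ℕ → V) → V) : (ℕ → (Fin n → ℤ)) → (ℕ → V) → V :=
  fun x X => sgn (((a₁ : ℤ) - 1) * (i : ℤ) + pairZ n κ₁ (κ₂ + ∑ l ∈ Finset.range i, x l)) •
      K₂ (insSeq a₁ i ((∑ m ∈ Finset.range a₁, x (m + i)) + κ₁) x)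
         (insSeq a₁ i (K₁ (shiftSeq x i) (shiftSeq X i)) X)

/-- `K` only depends on the first `a` entries -/
def Loc (a : ℕ) (K : (ℕ → (Fin n → ℤ)) → (ℕ → V) → V) : Prop :=
  ∀ y z Y Z, (∀ i, i < a → y i = z i) → (∀ i, i < a → Y i = Z i) → K y Y = K z Z

/-- the signed action of an adjacent transposition -/
def act (j : ℕ) (F : (ℕ → (Fin n → ℤ)) → (ℕ → V) → V) : (ℕ → (Fin n → ℤ)) → (ℕ → V) → V :=
  fun y Y => (- sgn (pairZ n (y j) (y (j + 1)))) •
      F (fun l => y (sw j l)) (fun l => Y (sw j l))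

theorem act_act (j : ℕ) (F : (ℕ → (Fin n → ℤ)) → (ℕ → V) → V) : act j (act j F) = F := by
  funext y Y
  have e1 : sw j j = j + 1 := by simp [sw]
  have e2 : sw j (j + 1) = j := by simp [sw]
  simp only [act, sw_sw, e1, e2, smul_smul]
  rw [pairZ_comm n (y (j + 1)), neg_mul_neg, sgn_mul_self, one_smul]

theorem ins_lt {β : Type*} {a i l : ℕ} (c : β) (f : ℕ → β) (h : l < i) :
    insSeq a i c f l = f l := by simp [insSeq, h]
theorem ins_eq {β : Type*} {a i : ℕ} (c : β) (f : ℕ → β) :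
    insSeq a i c f i = c := by simp [insSeq]
theorem ins_gt {β : Type*} {a i l : ℕ} (c : β) (f : ℕ → β) (h : i < l) :
    insSeq a i c f l = f (l + a - 1) := by
  unfold insSeq; rw [if_neg (by omega), if_neg (by omega)]

/-- hole to the right of the transposition -/
theorem ins_sw_right {β : Type*} (a i j : ℕ) (h : j + 1 < i) (c : β) (f : ℕ → β) :
    insSeq a i c (fun l => f (sw j l)) = fun l => insSeq a i c f (sw j l) := by
  funext l
  unfold insSeq
  by_cases h1 : l < i
  · have : sw j l < i := by unfold sw; split_ifs <;> omega
    simp [h1, this]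
  · have e : sw j l = l := by unfold sw; split_ifs <;> omega
    rw [e]
    split_ifs with h2
    · rfl
    · refine congrArg f ?_; unfold sw; split_ifs <;> omega

/-- hole to the left of the transposition -/
theorem ins_sw_left {β : Type*} (a i j : ℕ) (h : i < j) (c : β) (f : ℕ → β) :
    insSeq a i c (fun l => f (sw (j + a - 1) l)) = fun l => insSeq a i c f (sw j l) := by
  funext l
  unfold insSeq
  by_cases h1 : l ≤ i
  · have e : sw j l = l := by unfold sw; split_ifs <;> omega
    rw [e]
    split_ifs with h2
    · refine congrArg f ?_; unfold sw; split_ifs <;> omega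
    · rfl
    · omega
  · have : i < sw j l := by unfold sw; split_ifs <;> omega
    rw [if_neg (by omega), if_neg (by omega), if_neg (by omega), if_neg (by omega)]
    refine congrArg f ?_; clear this; unfold sw; split_ifs <;> omega

/-- transposition inside the block -/
theorem ins_sw_in {β : Type*} (a i j : ℕ) (h : j + 1 < a) (c : β) (f : ℕ → β) :
    insSeq a i c (fun l => f (sw (j + i) l)) = insSeq a i c f := by
  funext l
  unfold insSeq
  split_ifs with h1 h2
  · refine congrArg f ?_; unfold sw; split_ifs <;> omega
  · rfl
  · refine congrArg f ?_; unfold sw; split_ifs <;> omega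

theorem ins_cyc {β : Type*} (a j : ℕ) (c : β) (f : ℕ → β) :
    insSeq a (j + 1) c (fun l => f (cyc j a l)) = fun l => insSeq a j c f (sw j l) := by
  funext l
  rcases lt_trichotomy l j with h | h | h
  · have e : sw j l = l := by unfold sw; split_ifs <;> omega
    rw [e, ins_lt _ _ h, ins_lt _ _ (by omega)]
    refine congrArg f ?_; unfold cyc; split_ifs <;> omega
  · subst h
    have e : sw l l = l + 1 := by unfold sw; split_ifs <;> omega
    rw [e, ins_lt _ _ (by omega), ins_gt _ _ (by omega)]
    refine congrArg f ?_; unfold cyc; split_ifs <;> omega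
  · by_cases h2 : l = j + 1
    · subst h2
      have e : sw j (j + 1) = j := by unfold sw; split_ifs <;> omega
      rw [e, ins_eq, ins_eq]
    · have e : sw j l = l := by unfold sw; split_ifs <;> omega
      rw [e, ins_gt _ _ (by omega), ins_gt _ _ (by omega)]
      refine congrArg f ?_; unfold cyc; split_ifs <;> omega

theorem sum_range_sw {M : Type*} [AddCommMonoid M] (i j : ℕ) (h : j + 1 < i) (f : ℕ → M) :
    ∑ l ∈ Finset.range i, f (sw j l) = ∑ l ∈ Finset.range i, f l := by
  refine Finset.sum_nbij' (sw j) (sw j) ?_ ?_ ?_ ?_ ?_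
  · intro l hl; simp only [Finset.mem_range] at *; unfold sw; split_ifs <;> omega
  · intro l hl; simp only [Finset.mem_range] at *; unfold sw; split_ifs <;> omega
  · intro l _; exact sw_sw j l
  · intro l _; exact sw_sw j l
  · intro l _; rfl

/-- key step: transposing two adjacent arguments of `K₂` -/
theorem CC_swap_mid (a₁ a₂ : ℕ) (κ₁ κ₂ : Fin n → ℤ) (j : ℕ) (hj : j + 1 < a₂)
    (K₁ K₂ : (ℕ → (Fin n → ℤ)) → (ℕ → V) → V) (hK : Loc a₁ K₁) :
    SS (a₁ + a₂ - 1) (CC a₁ κ₁ κ₂ j K₁ (act j K₂)) =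
      SS (a₁ + a₂ - 1) (CC a₁ κ₁ κ₂ (j + 1) K₁ K₂) := by
  rw [← SS_cyc (a₁ + a₂ - 1) j a₁ (by omega) (CC a₁ κ₁ κ₂ (j + 1) K₁ K₂)]
  congr 1
  funext y Y
  have c1 : ∀ l, l < j → cyc j a₁ l = l := by
    intro l hl; unfold cyc; split_ifs <;> omega
  have c2 : cyc j a₁ j = j + a₁ := by unfold cyc; split_ifs <;> omega
  have c3 : ∀ m, m < a₁ → cyc j a₁ (m + (j + 1)) = m + j := by
    intro m hm; unfold cyc; split_ifs <;> omega
  unfold CC act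
  simp only [ins_cyc]
  have eK : K₁ (shiftSeq (fun l => y (cyc j a₁ l)) (j + 1))
      (shiftSeq (fun l => Y (cyc j a₁ l)) (j + 1)) = K₁ (shiftSeq y j) (shiftSeq Y j) := by
    apply hK
    · intro m hm; simp only [shiftSeq, c3 m hm]
    · intro m hm; simp only [shiftSeq, c3 m hm]
  have eS : ∑ m ∈ Finset.range a₁, y (cyc j a₁ (m + (j + 1)))
      = ∑ m ∈ Finset.range a₁, y (m + j) :=
    Finset.sum_congr rfl fun m hm => by rw [c3 m (Finset.mem_range.1 hm)]
  have eP : ∑ l ∈ Finset.range (j + 1), y (cyc j a₁ l)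
      = (∑ l ∈ Finset.range j, y l) + y (j + a₁) := by
    rw [Finset.sum_range_succ, c2]
    congr 1
    exact Finset.sum_congr rfl fun m hm => by rw [c1 m (Finset.mem_range.1 hm)]
  rw [eK, eS, eP, smul_smul, smul_smul, ins_eq, ins_gt _ _ (by omega)]
  congr 1
  have e4 : j + 1 + a₁ - 1 = j + a₁ := by omega
  rw [e4]
  have eQ : ∏ t ∈ Finset.range a₁, -sgn (pairZ n (y (j + t)) (y (j + a₁)))
      = sgn (a₁ : ℤ) * sgn (pairZ n (∑ m ∈ Finset.range a₁, y (m + j)) (y (j + a₁))) := by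
    have : ∀ b : ℕ, ∏ t ∈ Finset.range b, -sgn (pairZ n (y (j + t)) (y (j + a₁)))
      = sgn (b : ℤ) * sgn (pairZ n (∑ m ∈ Finset.range b, y (m + j)) (y (j + a₁))) := by
      intro b
      induction b with
      | zero => simp [sgn_zero, pairZ]
      | succ b ih =>
        rw [Finset.prod_range_succ, ih, Finset.sum_range_succ, pairZ_add_left, sgn_add,
          Nat.cast_succ, sgn_add, sgn_one, add_comm b j]
        ring
    exact this a₁
  rw [eQ]
  have e5 : ((a₁ : ℤ) - 1) * ((j + 1 : ℕ) : ℤ) = ((a₁ : ℤ) - 1) * j + (a₁ + (-1)) := by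
    push_cast; ring
  have em : sgn (-1) = -1 := by simp [sgn]
  rw [e5]
  simp only [pairZ_add_right, pairZ_add_left, sgn_add, em]
  have := sgn_mul_self (a₁ : ℤ)
  linear_combination (-sgn (((a₁ : ℤ) - 1) * j) * sgn (pairZ n κ₁ κ₂) *
    sgn (pairZ n κ₁ (∑ l ∈ Finset.range j, y l)) * sgn (pairZ n κ₁ (y (j + a₁))) *
    sgn (pairZ n (∑ m ∈ Finset.range a₁, y (m + j)) (y (j + a₁)))) * (-this)

theorem CC_swap (a₁ a₂ : ℕ) (κ₁ κ₂ : Fin n → ℤ) (i j : ℕ) (hi : i < a₂) (hj : j + 1 < a₂)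
    (K₁ K₂ : (ℕ → (Fin n → ℤ)) → (ℕ → V) → V) (hK : Loc a₁ K₁) :
    SS (a₁ + a₂ - 1) (CC a₁ κ₁ κ₂ i K₁ (act j K₂)) =
      SS (a₁ + a₂ - 1) (CC a₁ κ₁ κ₂ (sw j i) K₁ K₂) := by
  by_cases h1 : i = j
  · subst h1
    have : sw i i = i + 1 := by simp [sw]
    rw [this, CC_swap_mid a₁ a₂ κ₁ κ₂ i hj K₁ K₂ hK]
  by_cases h2 : i = j + 1
  · subst h2
    have : sw j (j + 1) = j := by simp [sw]
    rw [this, ← CC_swap_mid a₁ a₂ κ₁ κ₂ j hj K₁ (act j K₂) hK, act_act]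
  have h3 : sw j i = i := by unfold sw; split_ifs <;> omega
  rw [h3]
  rcases lt_or_gt_of_ne h1 with h | h
  · -- hole on the left
    rw [← SS_swap (a₁ + a₂ - 1) (j + a₁ - 1) (by omega) (CC a₁ κ₁ κ₂ i K₁ K₂)]
    congr 1
    funext y Y
    unfold CC act
    simp only [ins_sw_left a₁ i j h]
    have c : ∀ m, m < a₁ + i → sw (j + a₁ - 1) m = m := by
      intro m hm; unfold sw; split_ifs <;> omega
    have eK : K₁ (shiftSeq (fun l => y (sw (j + a₁ - 1) l)) i)
        (shiftSeq (fun l => Y (sw (j + a₁ - 1) l)) i) = K₁ (shiftSeq y i) (shiftSeq Y i) := by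
      apply hK
      · intro m hm; simp only [shiftSeq, c (m + i) (by omega)]
      · intro m hm; simp only [shiftSeq, c (m + i) (by omega)]
    have eS : ∑ m ∈ Finset.range a₁, y (sw (j + a₁ - 1) (m + i))
        = ∑ m ∈ Finset.range a₁, y (m + i) :=
      Finset.sum_congr rfl fun m hm => by
        rw [c (m + i) (by have := Finset.mem_range.1 hm; omega)]
    have eP : ∑ l ∈ Finset.range i, y (sw (j + a₁ - 1) l) = ∑ l ∈ Finset.range i, y l :=
      Finset.sum_congr rfl fun m hm => by
        rw [c m (by have := Finset.mem_range.1 hm; omega)]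
    rw [eK, eS, eP, smul_smul, smul_smul, mul_comm, ins_gt _ _ h, ins_gt _ _ (by omega)]
    have e : j + 1 + a₁ - 1 = j + a₁ - 1 + 1 := by omega
    rw [e]
  · have hji : j + 1 < i := by omega
    rw [← SS_swap (a₁ + a₂ - 1) j (by omega) (CC a₁ κ₁ κ₂ i K₁ K₂)]
    congr 1
    funext y Y
    unfold CC act
    simp only [ins_sw_right a₁ i j hji]
    have c : ∀ m, sw j (m + i) = m + i := by
      intro m; unfold sw; split_ifs <;> omega
    have eSh : shiftSeq (fun l => y (sw j l)) i = shiftSeq y i := by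
      funext m; simp only [shiftSeq, c]
    have eSh2 : shiftSeq (fun l => Y (sw j l)) i = shiftSeq Y i := by
      funext m; simp only [shiftSeq, c]
    rw [eSh, eSh2]
    simp only [c, sum_range_sw i j hji]
    rw [smul_smul, smul_smul, mul_comm, ins_lt _ _ h, ins_lt _ _ hji]

/-- the signed action of a permutation -/
def pact (a : ℕ) (σ : Equiv.Perm (Fin a)) (F : (ℕ → (Fin n → ℤ)) → (ℕ → V) → V) :
    (ℕ → (Fin n → ℤ)) → (ℕ → V) → V :=
  fun y Y => gsign (pairZ n) a σ y • F (permSeq a σ y) (permSeq a σ Y)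

theorem pact_swp_mul (a j : ℕ) (h : j + 1 < a) (τ : Equiv.Perm (Fin a)) (F : (ℕ → (Fin n → ℤ)) → (ℕ → V) → V) :
    pact a (swp a j h * τ) F = act j (pact a τ F) := by
  funext y Y
  unfold pact act
  rw [gsign_mul _ (pairZ_comm n), gsign_swp _ (pairZ_comm n), permSeq_mul, permSeq_mul,
    permSeq_swp, permSeq_swp, mul_smul]

theorem pact_one (a : ℕ) (F : (ℕ → (Fin n → ℤ)) → (ℕ → V) → V) : pact a 1 F = F := by
  funext y Y
  simp [pact, gsign_one, permSeq_one]

theorem CC_perm (a₁ a₂ : ℕ) (κ₁ κ₂ : Fin n → ℤ)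
    (K₁ K₂ : (ℕ → (Fin n → ℤ)) → (ℕ → V) → V) (hK : Loc a₁ K₁) (τ : Equiv.Perm (Fin a₂)) :
    ∀ i : Fin a₂, SS (a₁ + a₂ - 1) (CC a₁ κ₁ κ₂ i K₁ (pact a₂ τ K₂)) =
      SS (a₁ + a₂ - 1) (CC a₁ κ₁ κ₂ ((τ⁻¹ i : Fin a₂) : ℕ) K₁ K₂) := by
  induction τ using perm_ind with
  | h1 => intro i; simp [pact_one]
  | hs j h τ ih =>
    intro i
    rw [pact_swp_mul, CC_swap a₁ a₂ κ₁ κ₂ i j i.2 h _ _ hK, ← swp_val a₂ j h, ih]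
    have : (swp a₂ j h)⁻¹ = swp a₂ j h := Equiv.swap_inv _ _
    rw [mul_inv_rev, Equiv.Perm.mul_apply, this]

/-- permuting the arguments of `K₁` with the sign pulled out -/
def AA (a₁ : ℕ) (κ₁ κ₂ : Fin n → ℤ) (i : ℕ) (σ : Equiv.Perm (Fin a₁))
    (K₁ K₂ : (ℕ → (Fin n → ℤ)) → (ℕ → V) → V) : (ℕ → (Fin n → ℤ)) → (ℕ → V) → V :=
  fun x X => gsign (pairZ n) a₁ σ (shiftSeq x i) •
    CC a₁ κ₁ κ₂ i (fun y Y => K₁ (permSeq a₁ σ y) (permSeq a₁ σ Y)) K₂ x X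

theorem AA_perm (a₁ a₂ : ℕ) (κ₁ κ₂ : Fin n → ℤ) (i : ℕ) (hi : i < a₂)
    (K₁ K₂ : (ℕ → (Fin n → ℤ)) → (ℕ → V) → V) (σ : Equiv.Perm (Fin a₁)) :
    SS (a₁ + a₂ - 1) (AA a₁ κ₁ κ₂ i σ K₁ K₂) = SS (a₁ + a₂ - 1) (CC a₁ κ₁ κ₂ i K₁ K₂) := by
  induction σ using perm_ind with
  | h1 =>
    congr 1
    funext y Y
    simp [AA, gsign_one, permSeq_one]
  | hs j h σ ih =>
    rw [← ih, ← SS_swap (a₁ + a₂ - 1) (j + i) (by omega) (AA a₁ κ₁ κ₂ i σ K₁ K₂)]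
    congr 1
    funext y Y
    unfold AA CC
    have c : ∀ m, sw (j + i) (m + i) = sw j m + i := by
      intro m; unfold sw; split_ifs <;> omega
    have cLow : ∀ l, l < i → sw (j + i) l = l := by
      intro l hl; unfold sw; split_ifs <;> omega
    have eP : ∑ l ∈ Finset.range i, y (sw (j + i) l) = ∑ l ∈ Finset.range i, y l :=
      Finset.sum_congr rfl fun m hm => by rw [cLow m (Finset.mem_range.1 hm)]
    have eSh : shiftSeq (fun l => y (sw (j + i) l)) i
        = fun l => shiftSeq y i (sw j l) := by
      funext m; simp only [shiftSeq, c]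
    have eSh2 : shiftSeq (fun l => Y (sw (j + i) l)) i
        = fun l => shiftSeq Y i (sw j l) := by
      funext m; simp only [shiftSeq, c]
    rw [eSh, eSh2]
    have eS : ∑ m ∈ Finset.range a₁, y (sw j m + i) = ∑ m ∈ Finset.range a₁, y (m + i) :=
      sum_range_sw a₁ j h (fun m => y (m + i))
    simp only [ins_sw_in a₁ i j h, eP, c, eS]
    rw [gsign_mul _ (pairZ_comm n), gsign_swp _ (pairZ_comm n)]
    simp only [permSeq_mul, permSeq_swp, mul_smul]
    have e1 : shiftSeq y i j = y (j + i) := rfl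
    have e2 : shiftSeq y i (j + 1) = y (j + i + 1) := by
      unfold shiftSeq; congr 1; omega
    rw [e1, e2]

end Alternator

section Final

variable {𝕂 : Type*} [Field 𝕂] {n : ℕ} {V : Type*} [AddCommGroup V] [Module 𝕂 V]

theorem alt_eq_SS (N : ℕ) (F : (ℕ → (Fin n → ℤ)) → (ℕ → V) → V) (y : ℕ → (Fin n → ℤ)) (Y : ℕ → V) :
    alt 𝕂 (pairZ n) N F y Y = (N.factorial : 𝕂)⁻¹ • SS N F y Y := by
  simp only [alt, SS, Int.cast_smul_eq_zsmul]

theorem alt_eq_pact (N : ℕ) (F : (ℕ → (Fin n → ℤ)) → (ℕ → V) → V) (y : ℕ → (Fin n → ℤ)) (Y : ℕ → V) :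
    alt 𝕂 (pairZ n) N F y Y = (N.factorial : 𝕂)⁻¹ • ∑ σ, pact N σ F y Y := by
  simp only [alt, pact, Int.cast_smul_eq_zsmul]

theorem SS_sum {ι : Type*} (s : Finset ι) (N : ℕ) (F : ι → (ℕ → (Fin n → ℤ)) → (ℕ → V) → V) (y : ℕ → (Fin n → ℤ))
    (Y : ℕ → V) :
    SS N (fun y Y => ∑ i ∈ s, F i y Y) y Y = ∑ i ∈ s, SS N (F i) y Y := by
  simp only [SS, Finset.smul_sum]
  exact Finset.sum_comm

theorem SS_smul (N : ℕ) (c : 𝕂) (F : (ℕ → (Fin n → ℤ)) → (ℕ → V) → V) (y : ℕ → (Fin n → ℤ)) (Y : ℕ → V) :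
    SS N (fun y Y => c • F y Y) y Y = c • SS N F y Y := by
  simp only [SS, Finset.smul_sum]
  exact Finset.sum_congr rfl fun ρ _ => smul_comm _ _ _

theorem SS_jop (N a₁ a₂ : ℕ) (κ₁ κ₂ : Fin n → ℤ) (K₁ K₂ : (ℕ → (Fin n → ℤ)) → (ℕ → V) → V) (y : ℕ → (Fin n → ℤ))
    (Y : ℕ → V) :
    SS N (jop (pairZ n) a₁ κ₁ a₂ κ₂ K₁ K₂) y Y
      = ∑ i : Fin a₂, SS N (CC a₁ κ₁ κ₂ i K₁ K₂) y Y := by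
  rw [← SS_sum]
  congr 1
  funext y Y
  rw [Fin.sum_univ_eq_sum_range (fun i => CC a₁ κ₁ κ₂ i K₁ K₂ y Y) a₂]
  rfl

theorem Loc_alt {a : ℕ} {K : (ℕ → (Fin n → ℤ)) → (ℕ → V) → V} (h : IsML 𝕂 a K) : Loc a (alt 𝕂 (pairZ n) a K) := by
  intro y y' Y Y' hy hY
  unfold alt
  congr 1
  refine Finset.sum_congr rfl fun σ _ => ?_
  rw [gsign_congr _ a σ y y' hy, h.1 _ (permSeq a σ y')]
  congr 1
  refine h.2.1 _ _ _ fun i hi => ?_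
  simp only [permSeq, hi, dif_pos]
  exact hY _ (σ ⟨i, hi⟩).2

theorem SS_alt_right [CharZero 𝕂] (a₁ a₂ : ℕ) (κ₁ κ₂ : Fin n → ℤ) (K₁ K₂ : (ℕ → (Fin n → ℤ)) → (ℕ → V) → V)
    (hK : Loc a₁ K₁) (y : ℕ → (Fin n → ℤ)) (Y : ℕ → V) :
    SS (a₁ + a₂ - 1) (jop (pairZ n) a₁ κ₁ a₂ κ₂ K₁ (alt 𝕂 (pairZ n) a₂ K₂)) y Y =
    SS (a₁ + a₂ - 1) (jop (pairZ n) a₁ κ₁ a₂ κ₂ K₁ K₂) y Y := by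
  rw [SS_jop, SS_jop]
  have e : ∀ i : Fin a₂, CC a₁ κ₁ κ₂ i K₁ (alt 𝕂 (pairZ n) a₂ K₂) = fun y Y =>
      (a₂.factorial : 𝕂)⁻¹ • ∑ τ, CC a₁ κ₁ κ₂ i K₁ (pact a₂ τ K₂) y Y := by
    intro i
    funext y Y
    unfold CC
    rw [alt_eq_pact, smul_comm, Finset.smul_sum]
  simp only [e, SS_smul, SS_sum]
  rw [← Finset.smul_sum, Finset.sum_comm]
  simp only [CC_perm a₁ a₂ κ₁ κ₂ K₁ K₂ hK]
  have e2 : ∀ τ : Equiv.Perm (Fin a₂),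
      ∑ i : Fin a₂, SS (a₁ + a₂ - 1) (CC a₁ κ₁ κ₂ ((τ⁻¹ i : Fin a₂) : ℕ) K₁ K₂) y Y
      = ∑ i : Fin a₂, SS (a₁ + a₂ - 1) (CC a₁ κ₁ κ₂ i K₁ K₂) y Y := fun τ =>
    Equiv.sum_comp τ⁻¹ (fun i : Fin a₂ => SS (a₁ + a₂ - 1) (CC a₁ κ₁ κ₂ i K₁ K₂) y Y)
  simp only [e2]
  rw [Finset.sum_const, Finset.card_univ, Fintype.card_perm, Fintype.card_fin,
    ← Nat.cast_smul_eq_nsmul 𝕂, smul_smul, inv_mul_cancel₀, one_smul]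
  exact_mod_cast a₂.factorial_ne_zero

theorem ins_update {β : Type*} (a i : ℕ) (c d : β) (f : ℕ → β) :
    insSeq a i c f = Function.update (insSeq a i d f) i c := by
  funext l
  unfold insSeq
  by_cases h : l = i
  · subst h; simp
  · simp [h]

/-- `K` as a linear map in slot `i` -/
def linSlot {a : ℕ} {K : (ℕ → (Fin n → ℤ)) → (ℕ → V) → V} (h : IsML 𝕂 a K)
    (x : ℕ → (Fin n → ℤ)) (X : ℕ → V) (i : ℕ) (hi : i < a) : V →ₗ[𝕂] V where
  toFun u := K x (Function.update X i u)
  map_add' := (h.2.2 x X i hi).1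
  map_smul' := (h.2.2 x X i hi).2

theorem SS_alt_left [CharZero 𝕂] (a₁ a₂ : ℕ) (κ₁ κ₂ : Fin n → ℤ) (K₁ K₂ : (ℕ → (Fin n → ℤ)) → (ℕ → V) → V)
    (hK : IsML 𝕂 a₂ K₂) (y : ℕ → (Fin n → ℤ)) (Y : ℕ → V) :
    SS (a₁ + a₂ - 1) (jop (pairZ n) a₁ κ₁ a₂ κ₂ (alt 𝕂 (pairZ n) a₁ K₁) K₂) y Y =
    SS (a₁ + a₂ - 1) (jop (pairZ n) a₁ κ₁ a₂ κ₂ K₁ K₂) y Y := by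
  rw [SS_jop, SS_jop]
  refine Finset.sum_congr rfl fun i _ => ?_
  have e : CC a₁ κ₁ κ₂ i (alt 𝕂 (pairZ n) a₁ K₁) K₂ = fun y Y =>
      (a₁.factorial : 𝕂)⁻¹ • ∑ σ, AA a₁ κ₁ κ₂ i σ K₁ K₂ y Y := by
    funext y Y
    unfold AA CC
    have hl : ∀ x c, K₂ x (insSeq a₁ i c Y) = linSlot hK x (insSeq a₁ i 0 Y) i i.2 c := by
      intro x c
      rw [ins_update a₁ i c 0 Y]; rfl
    simp only [hl]
    rw [alt_eq_pact, map_smul, map_sum, smul_comm, Finset.smul_sum]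
    congr 1
    refine Finset.sum_congr rfl fun σ _ => ?_
    unfold pact
    rw [map_zsmul, smul_comm]
  rw [e, SS_smul, SS_sum]
  simp only [AA_perm a₁ a₂ κ₁ κ₂ i i.2]
  rw [Finset.sum_const, Finset.card_univ, Fintype.card_perm, Fintype.card_fin,
    ← Nat.cast_smul_eq_nsmul 𝕂, smul_smul, inv_mul_cancel₀, one_smul]
  exact_mod_cast a₁.factorial_ne_zero

end Final

/-- For the multigraded alternator `α` and homogeneous
`K₁ ∈ M^{(k₁,κ₁)}(V)`, `K₂ ∈ M^{(k₂,κ₂)}(V)` one has `α(j(αK₁)(αK₂)) = α(j(K₁)K₂)`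
(evaluated on homogeneous arguments; arities `aᵢ = kᵢ+1`). -/
theorem stmt7 {𝕂 : Type} [Field 𝕂] [CharZero 𝕂] (n : ℕ)
    {V : Type} [AddCommGroup V] [Module 𝕂 V]
    (gr : (Fin n → ℤ) → Submodule 𝕂 V) (hgr : DirectSum.IsInternal gr)
    (a₁ a₂ : ℕ) (κ₁ κ₂ : Fin n → ℤ)
    (K₁ K₂ : (ℕ → (Fin n → ℤ)) → (ℕ → V) → V)
    (h₁ : MDeg 𝕂 gr a₁ κ₁ K₁) (h₂ : MDeg 𝕂 gr a₂ κ₂ K₂) :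
    ∀ x X, (∀ i, X i ∈ gr (x i)) →
      alt 𝕂 (pairZ n) (a₁ + a₂ - 1)
          (jop (pairZ n) a₁ κ₁ a₂ κ₂ (alt 𝕂 (pairZ n) a₁ K₁) (alt 𝕂 (pairZ n) a₂ K₂)) x X
        = alt 𝕂 (pairZ n) (a₁ + a₂ - 1) (jop (pairZ n) a₁ κ₁ a₂ κ₂ K₁ K₂) x X := by
  intro x X _
  rw [alt_eq_SS, alt_eq_SS, SS_alt_right a₁ a₂ κ₁ κ₂ _ K₂ (Loc_alt h₁.1), SS_alt_left a₁ a₂ κ₁ κ₂ K₁ K₂ h₂.1]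

end NR
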